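/- Let X be a finite-dimensional real normed vector space, A be a closed set, and f and φ be lower semicontinuous on A. Then the penalty function F_λ is exact on every bounded subset C ⊂ A if and only if F_λ is exact at every globally optimal solution of the problem (P). -/

import Mathlib

open Filter Topology Set

/-- The linear penalty function `F_λ = f + λ φ`. -/
noncomputable def penaltyFun {X : Type*} (f : X → EReal) (φ : X → ℝ) (lam : ℝ) : X → EReal :=
  fun x => f x + ((lam * φ x : ℝ) : EReal)

/-- The penalty function `F_λ` is (locally) exact at `x`. -/
def ExactPenaltyAt {X : Type*} [TopologicalSpace X] (f : X → EReal) (φ : X → ℝ)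
    (A : Set X) (x : X) : Prop :=
  ∃ lam : ℝ, 0 ≤ lam ∧ IsLocalMinOn (penaltyFun f φ lam) A x

/-- The penalty function `F_λ` is exact on the set `C` (relative to the optimal value
`fstar` of the problem `(𝒫)`). -/
def ExactOnSet {X : Type*} (f : X → EReal) (φ : X → ℝ) (fstar : EReal) (C : Set X) : Prop :=
  ∃ ls : ℝ, 0 ≤ ls ∧ ∀ lam : ℝ, ls ≤ lam → ∀ x ∈ C, fstar ≤ penaltyFun f φ lam x

theorem penaltyFun_mono {X : Type*} (f : X → EReal) {φ : X → ℝ} {x : X} (hx : 0 ≤ φ x)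
    {a b : ℝ} (hab : a ≤ b) : penaltyFun f φ a x ≤ penaltyFun f φ b x := by
  unfold penaltyFun
  gcongr

theorem penaltyFun_of_eq_zero {X : Type*} (f : X → EReal) {φ : X → ℝ} {x : X} (hx : φ x = 0)
    (lam : ℝ) : penaltyFun f φ lam x = f x := by
  simp [penaltyFun, hx]

theorem le_penaltyFun {X : Type*} (f : X → EReal) {φ : X → ℝ} {x : X} (hx : 0 ≤ φ x)
    {lam : ℝ} (hlam : 0 ≤ lam) : f x ≤ penaltyFun f φ lam x := by
  simpa [penaltyFun] using penaltyFun_mono f hx hlam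

theorem exactOnSet_of_forall_le {X : Type*} {f : X → EReal} {φ : X → ℝ} (hφ : ∀ x, 0 ≤ φ x)
    {m : EReal} {C : Set X} {lam : ℝ} (hlam : 0 ≤ lam)
    (h : ∀ x ∈ C, m ≤ penaltyFun f φ lam x) : ExactOnSet f φ m C :=
  ⟨lam, hlam, fun _ hmu x hx => (h x hx).trans (penaltyFun_mono f (hφ x) hmu)⟩

theorem ExactOnSet.mono {X : Type*} {f : X → EReal} {φ : X → ℝ} {m : EReal} {C D : Set X}
    (h : ExactOnSet f φ m D) (hCD : C ⊆ D) : ExactOnSet f φ m C := by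
  obtain ⟨lam, hlam, H⟩ := h
  exact ⟨lam, hlam, fun mu hmu x hx => H mu hmu x (hCD hx)⟩

theorem ExactOnSet.union {X : Type*} {f : X → EReal} {φ : X → ℝ} {m : EReal} {C D : Set X}
    (hC : ExactOnSet f φ m C) (hD : ExactOnSet f φ m D) : ExactOnSet f φ m (C ∪ D) := by
  obtain ⟨a, ha, HC⟩ := hC
  obtain ⟨b, -, HD⟩ := hD
  refine ⟨max a b, ha.trans (le_max_left _ _), fun mu hmu x hx => ?_⟩
  rcases hx with hx | hx
  · exact HC mu ((le_max_left _ _).trans hmu) x hx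
  · exact HD mu ((le_max_right _ _).trans hmu) x hx

/-- A set is exact as soon as it is compact and every point has an exact neighbourhood in it. -/
theorem IsCompact.exactOnSet {X : Type*} [TopologicalSpace X] {f : X → EReal} {φ : X → ℝ}
    {m : EReal} {K : Set X} (hK : IsCompact K)
    (h : ∀ x ∈ K, ∃ t ∈ 𝓝[K] x, ExactOnSet f φ m t) : ExactOnSet f φ m K :=
  hK.induction_on ⟨0, le_rfl, by simp⟩ (fun _ _ hst ht => ht.mono hst)
    (fun _ _ hs ht => hs.union ht) h

/-- Near an infeasible point a large penalty parameter lifts the penalty function above any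
real level. -/
theorem exists_exactOnSet_nhdsWithin_of_pos {X : Type*} [TopologicalSpace X] {f : X → EReal}
    {φ : X → ℝ} {A : Set X} {a : X} (hφ : ∀ x, 0 ≤ φ x) (hfa : f a ≠ ⊥)
    (hf : LowerSemicontinuousWithinAt f A a) (hφa : LowerSemicontinuousWithinAt φ A a)
    (hpos : 0 < φ a) (r : ℝ) : ∃ t ∈ 𝓝[A] a, ExactOnSet f φ (r : EReal) t := by
  obtain ⟨c, -, hc⟩ := EReal.lt_iff_exists_real_btwn.1 (bot_lt_iff_ne_bot.2 hfa)
  refine ⟨_, (hf c hc).and (hφa (φ a / 2) (by linarith)),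
    exactOnSet_of_forall_le hφ (lam := max 0 ((r - c) / (φ a / 2))) (le_max_left _ _) ?_⟩
  rintro x ⟨hx, hx'⟩
  have key : r - c ≤ max 0 ((r - c) / (φ a / 2)) * φ x :=
    calc r - c = (r - c) / (φ a / 2) * (φ a / 2) := by field_simp
      _ ≤ max 0 ((r - c) / (φ a / 2)) * φ x := by
        gcongr
        exact le_max_right _ _
  calc (r : EReal) = (c : EReal) + ((r - c : ℝ) : EReal) := by
        rw [← EReal.coe_add]; congr 1; ring
    _ ≤ penaltyFun f φ (max 0 ((r - c) / (φ a / 2))) x :=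
        add_le_add hx.le (EReal.coe_le_coe_iff.2 key)

/-- Theorem: in a finite-dimensional normed space, with `A` closed and `f`, `φ` l.s.c. on
`A`, the penalty function `F_λ` is exact on every bounded subset `C ⊂ A` iff it is exact
at every globally optimal solution of the problem `(𝒫)`. -/
theorem exactOn_bounded_iff_exact_at_solutions {X : Type*}
    [NormedAddCommGroup X] [NormedSpace ℝ X] [FiniteDimensional ℝ X]
    (f : X → EReal) (φ : X → ℝ) (A M : Set X)
    (hAne : A.Nonempty) (hMne : M.Nonempty)
    (hfbot : ∀ x, f x ≠ ⊥) (hφnn : ∀ x, 0 ≤ φ x) (hMdef : M = {x | φ x = 0})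
    (xstar : X) (hxstar : xstar ∈ M ∩ A) (hmin : ∀ y ∈ M ∩ A, f xstar ≤ f y)
    (hfinite : f xstar ≠ ⊤)
    (hAclosed : IsClosed A)
    (hflsc : LowerSemicontinuousOn f A)
    (hφlsc : LowerSemicontinuousOn (fun x => (φ x : ℝ)) A) :
    (∀ C : Set X, C.Nonempty → C ⊆ A → Bornology.IsBounded C →
        ExactOnSet f φ (f xstar) C) ↔
      (∀ xs : X, xs ∈ M ∩ A → (∀ y ∈ M ∩ A, f xs ≤ f y) → f xs ≠ ⊤ →
        ExactPenaltyAt f φ A xs) := by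
  subst hMdef
  constructor
  · intro h xs hxs hxsmin _
    obtain ⟨lam, hlam, H⟩ := h (A ∩ Metric.ball xs 1) ⟨xs, hxs.2, Metric.mem_ball_self one_pos⟩
      inter_subset_left (Metric.isBounded_ball.subset inter_subset_right)
    refine ⟨lam, hlam, ?_⟩
    filter_upwards [inter_mem_nhdsWithin A (Metric.ball_mem_nhds xs one_pos)] with x hx
    rw [penaltyFun_of_eq_zero f hxs.1]
    exact (hxsmin xstar hxstar).trans (H lam le_rfl x hx)
  · intro h C _ hCA hCb
    have hKA : closure C ⊆ A := closure_minimal hCA hAclosed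
    refine (IsCompact.exactOnSet hCb.isCompact_closure fun a ha => ?_).mono subset_closure
    suffices H : ∃ t ∈ 𝓝[A] a, ExactOnSet f φ (f xstar) t by
      obtain ⟨t, ht, hex⟩ := H
      exact ⟨t, nhdsWithin_mono a hKA ht, hex⟩
    have haA := hKA ha
    rcases (hφnn a).eq_or_lt with h0 | hpos
    · rcases (hmin a ⟨h0.symm, haA⟩).eq_or_lt with heq | hlt
      · obtain ⟨lam, hlam, hloc⟩ := h a ⟨h0.symm, haA⟩ (heq ▸ hmin) (heq ▸ hfinite)
        refine ⟨_, hloc, exactOnSet_of_forall_le hφnn hlam fun x hx => ?_⟩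
        rw [heq, ← penaltyFun_of_eq_zero f h0.symm lam]
        exact hx
      · exact ⟨_, hflsc a haA _ hlt, exactOnSet_of_forall_le hφnn le_rfl fun x hx =>
          (le_of_lt hx).trans (le_penaltyFun f (hφnn x) le_rfl)⟩
    · rw [← EReal.coe_toReal hfinite (hfbot xstar)]
      exact exists_exactOnSet_nhdsWithin_of_pos hφnn (hfbot a) (hflsc a haA) (hφlsc a haA) hpos _
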